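/- arXiv:2105.11919 — 7 statements merged into one kernel-verified Lean document; each statement's English description precedes it below -/
import Mathlib

section
/- Sufficiency part of Theorem 1 (minmax characterization): Let N be a natural number and consider a run of the bracketing model with Δ_0 = n ≤ 2^N. If at every step j (while Δ_j > 1) the probe satisfies |k_j − x_{1/2,j}| ≤ 2^{N−j−1} − Δ_j/2, then Δ_j ≤ 2^{N−j} for every j, and in particular Δ_N ≤ 1, i.e., the run terminates within at most N iterations. -/
/-- **Sufficiency part of Theorem 1 (minmax characterization).**
Bracketing model: `a 0 = 0`, `b 0 = n`; while `b j - a j > 1` a probe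
`a j < k j < b j` is made and `(a (j+1), b (j+1))` is one of
`(a j, k j)`, `(k j, b j)`, `(k j, k j + 1)`; once `b j - a j ≤ 1` the
bracket is frozen (the run has terminated). If `n ≤ 2^N` and every probe
satisfies `|k_j − x_{1/2,j}| ≤ 2^{N−j−1} − Δ_j/2`, then `Δ_j ≤ 2^{N−j}`
for every `j ≤ N`, and in particular `Δ_N ≤ 1`. -/
theorem minmax_sufficiency
    (n : ℤ) (hn : 2 ≤ n) (N : ℕ) (hN : n ≤ 2 ^ N)
    (a b k : ℕ → ℤ) (ha0 : a 0 = 0) (hb0 : b 0 = n)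
    (hrun : ∀ j : ℕ,
      (1 < b j - a j → a j < k j ∧ k j < b j ∧
        ((a (j+1) = a j ∧ b (j+1) = k j) ∨
         (a (j+1) = k j ∧ b (j+1) = b j) ∨
         (a (j+1) = k j ∧ b (j+1) = k j + 1))) ∧
      (b j - a j ≤ 1 → a (j+1) = a j ∧ b (j+1) = b j))
    (hprobe : ∀ j : ℕ, 1 < b j - a j →
      |(k j : ℝ) - ((a j : ℝ) + (b j : ℝ)) / 2|
        ≤ 2 ^ ((N : ℤ) - j - 1) - ((b j : ℝ) - (a j : ℝ)) / 2) :
    (∀ j ≤ N, b j - a j ≤ 2 ^ (N - j)) ∧ b N - a N ≤ 1 := by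
  have width : ∀ j ≤ N, b j - a j ≤ 2 ^ (N - j) := by
    intro j
    induction j with
    | zero => simpa [ha0, hb0] using hN
    | succ j ih =>
      intro hj
      have hpos : (1 : ℤ) ≤ 2 ^ (N - (j + 1)) := one_le_pow₀ (by norm_num)
      by_cases hgap : 1 < b j - a j
      · have hexp : (N : ℤ) - j - 1 = ((N - (j + 1) : ℕ) : ℤ) := by omega
        have hp := hprobe j hgap
        rw [hexp, zpow_natCast, abs_le] at hp
        obtain ⟨hp₁, hp₂⟩ := hp
        have hleft : k j - a j ≤ 2 ^ (N - (j + 1)) := by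
          have h : (k j : ℝ) - a j ≤ 2 ^ (N - (j + 1)) := by linarith
          exact_mod_cast h
        have hright : b j - k j ≤ 2 ^ (N - (j + 1)) := by
          have h : (b j : ℝ) - k j ≤ 2 ^ (N - (j + 1)) := by linarith
          exact_mod_cast h
        obtain ⟨-, -, ⟨h₁, h₂⟩ | ⟨h₁, h₂⟩ | ⟨h₁, h₂⟩⟩ := (hrun j).1 hgap <;>
          rw [h₁, h₂] <;> linarith
      · obtain ⟨h₁, h₂⟩ := (hrun j).2 (not_lt.mp hgap)
        rw [h₁, h₂]
        linarith
  exact ⟨width, by simpa using width N le_rfl⟩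
end

section
/- Necessity part of Theorem 1 (minmax characterization): Let N be a natural number and suppose a run of the bracketing model reaches a step j with Δ_j ≥ 2 at which the probe satisfies |k_j − x_{1/2,j}| > 2^{N−j−1} − Δ_j/2. Then max(b_j − k_j, k_j − a_j) > 2^{N−j−1}; moreover, for every rule choosing the subsequent probes there exists a choice of the subsequent updates, each taken from {(a_i, k_i), (k_i, b_i)} by always selecting the larger of the two sides, under which Δ_m ≥ 2^{−(m−j−1)} · max(b_j − k_j, k_j − a_j) for all m > j, so that Δ_N > 1 and the run does not terminate within N iterations. -/
/-- One update of the bracket `p` with probe rule `K`: keep the larger of the two sides, and leave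
a bracket of size at most one unchanged. -/
def largerSide (K : ℤ → ℤ → ℤ) (p : ℤ × ℤ) : ℤ × ℤ :=
  if 1 < p.2 - p.1 then
    if K p.1 p.2 - p.1 ≤ p.2 - K p.1 p.2 then (K p.1 p.2, p.2) else (p.1, K p.1 p.2)
  else p

theorem le_two_mul_largerSide (K : ℤ → ℤ → ℤ) (p : ℤ × ℤ) (hp : 0 ≤ p.2 - p.1) :
    p.2 - p.1 ≤ 2 * ((largerSide K p).2 - (largerSide K p).1) := by
  unfold largerSide
  split_ifs <;> omega

theorem le_two_pow_mul_iterate_largerSide (K : ℤ → ℤ → ℤ) (p : ℤ × ℤ) (hp : 0 ≤ p.2 - p.1)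
    (t : ℕ) :
    0 ≤ ((largerSide K)^[t] p).2 - ((largerSide K)^[t] p).1 ∧
      p.2 - p.1 ≤ 2 ^ t * (((largerSide K)^[t] p).2 - ((largerSide K)^[t] p).1) := by
  induction t with
  | zero => simpa using hp
  | succ t ih =>
    rw [Function.iterate_succ_apply']
    obtain ⟨h0, h1⟩ := ih
    have h2 := le_two_mul_largerSide K _ h0
    refine ⟨by omega, h1.trans ?_⟩
    rw [pow_succ, mul_assoc]
    gcongr


/-- **Necessity part of Theorem 1 (minmax characterization).**
Suppose a run of the bracketing model reaches a step `j` with `Δ_j ≥ 2` at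
which the probe `k j` violates the minmax condition, i.e.
`|k_j − x_{1/2,j}| > 2^{N−j−1} − Δ_j/2`.  Then
`max (b_j − k_j) (k_j − a_j) > 2^{N−j−1}`, and for every rule `K` choosing the
subsequent probes there is a continuation of the run whose updates are taken
from `{(a_i, k_i), (k_i, b_i)}` by always selecting the larger of the two
sides, under which `Δ_m ≥ 2^{−(m−j−1)} · max (b_j − k_j) (k_j − a_j)` for all
`m > j`; in particular `Δ_N > 1`, so the run does not terminate within `N`
iterations. -/
theorem minmax_necessity
    (n : ℤ) (hn : 2 ≤ n) (N j : ℕ)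
    (a b k : ℕ → ℤ) (ha0 : a 0 = 0) (hb0 : b 0 = n)
    (hrun : ∀ i < j, a i < k i ∧ k i < b i ∧
        ((a (i+1) = a i ∧ b (i+1) = k i) ∨
         (a (i+1) = k i ∧ b (i+1) = b i) ∨
         (a (i+1) = k i ∧ b (i+1) = k i + 1)))
    (hΔj : 2 ≤ b j - a j)
    (hka : a j < k j) (hkb : k j < b j)
    (hviol : 2 ^ ((N : ℤ) - j - 1) - ((b j : ℝ) - (a j : ℝ)) / 2
        < |(k j : ℝ) - ((a j : ℝ) + (b j : ℝ)) / 2|) :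
    (2 : ℝ) ^ ((N : ℤ) - j - 1) < ((max (b j - k j) (k j - a j) : ℤ) : ℝ) ∧
    ∀ K : ℤ → ℤ → ℤ, (∀ x y : ℤ, 1 < y - x → x < K x y ∧ K x y < y) →
      ∃ a' b' : ℕ → ℤ,
        (∀ i ≤ j, a' i = a i ∧ b' i = b i) ∧
        ((a' (j+1), b' (j+1)) =
          if k j - a j ≤ b j - k j then (k j, b j) else (a j, k j)) ∧
        (∀ i, j < i →
          (1 < b' i - a' i →
            (a' (i+1), b' (i+1)) =
              if K (a' i) (b' i) - a' i ≤ b' i - K (a' i) (b' i)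
              then (K (a' i) (b' i), b' i)
              else (a' i, K (a' i) (b' i))) ∧
          (b' i - a' i ≤ 1 → a' (i+1) = a' i ∧ b' (i+1) = b' i)) ∧
        (∀ m, j < m →
          (2 : ℝ) ^ (-((m : ℤ) - j - 1)) * ((max (b j - k j) (k j - a j) : ℤ) : ℝ)
            ≤ ((b' m - a' m : ℤ) : ℝ)) ∧
        1 < b' N - a' N := by
  have hmax : (2 : ℝ) ^ ((N : ℤ) - j - 1) < ((max (b j - k j) (k j - a j) : ℤ) : ℝ) := by
    push_cast
    rcases abs_cases ((k j : ℝ) - ((a j : ℝ) + (b j : ℝ)) / 2) with ⟨h, _⟩ | ⟨h, _⟩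
    · exact lt_max_of_lt_right (by linarith)
    · exact lt_max_of_lt_left (by linarith)
  refine ⟨hmax, fun K _ => ?_⟩
  set p : ℤ × ℤ := if k j - a j ≤ b j - k j then (k j, b j) else (a j, k j) with hp
  have hpΔ : p.2 - p.1 = max (b j - k j) (k j - a j) := by
    rw [hp]
    split_ifs <;> dsimp only <;> omega
  have hp0 : 0 ≤ p.2 - p.1 := by omega
  have hbound : ∀ m, j < m →
      (2 : ℝ) ^ (-((m : ℤ) - j - 1)) * ((max (b j - k j) (k j - a j) : ℤ) : ℝ) ≤
        ((((largerSide K)^[m - (j + 1)] p).2 - ((largerSide K)^[m - (j + 1)] p).1 : ℤ) : ℝ) := by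
    intro m hm
    obtain ⟨t, rfl⟩ := Nat.exists_eq_add_of_lt hm
    have h := (le_two_pow_mul_iterate_largerSide K p hp0 t).2
    rw [hpΔ] at h
    have he : -(((j + t + 1 : ℕ) : ℤ) - j - 1) = -(t : ℤ) := by push_cast; ring
    rw [he, zpow_neg, zpow_natCast, inv_mul_le_iff₀ (by positivity),
      show j + t + 1 - (j + 1) = t by omega]
    exact_mod_cast h
  have hanti : ∀ i ≤ j, b j - a j ≤ b i - a i := by
    intro i hi
    induction hi using Nat.decreasingInduction with
    | self => exact le_rfl
    | of_succ i hi ih =>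
      have := hrun i hi
      omega
  refine ⟨fun i => if i ≤ j then a i else ((largerSide K)^[i - (j + 1)] p).1,
    fun i => if i ≤ j then b i else ((largerSide K)^[i - (j + 1)] p).2,
    fun i hi => by simp [hi], by simp, fun i hi => ?_, fun m hm => ?_, ?_⟩
  · have h1 : ¬ i ≤ j := by omega
    have h2 : ¬ i + 1 ≤ j := by omega
    simp only [h1, h2, if_false, show i + 1 - (j + 1) = (i - (j + 1)) + 1 by omega,
      Function.iterate_succ_apply']
    refine ⟨fun h => ?_, fun h => ?_⟩
    · rw [Prod.mk.eta, largerSide, if_pos h]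
    · rw [largerSide, if_neg (not_lt.mpr h)]
      exact ⟨rfl, rfl⟩
  · simpa only [hm.not_ge, if_false] using hbound m hm
  · by_cases hN : N ≤ j
    · simp only [hN, if_true]
      have := hanti N hN
      omega
    · simp only [hN, if_false]
      have h := hbound N (not_le.mp hN)
      have h1 : (1 : ℝ) <
          2 ^ (-((N : ℤ) - j - 1)) * ((max (b j - k j) (k j - a j) : ℤ) : ℝ) := by
        rwa [zpow_neg, lt_inv_mul_iff₀ (by positivity), mul_one]
      exact_mod_cast h1.trans_le h
end

section
/- Local minmax variant (equation (8)): Consider a run of the bracketing model in which at every step j (while Δ_j > 1) the probe satisfies |k_j − x_{1/2,j}| ≤ 2^{⌈log_2 Δ_j⌉ − 1} − Δ_j/2. Then ⌈log_2 Δ_{j+1}⌉ ≤ ⌈log_2 Δ_j⌉ − 1 at every step, and consequently, for every j, the run terminates within at most ⌈log_2 Δ_j⌉ further iterations after step j (in particular within ⌈log_2 n⌉ iterations in total). -/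
/-- An integer bounds the rounded-up binary logarithm of `x` iff its power of two bounds `x`. -/
theorem ceil_logb_two_le_iff {x : ℝ} (hx : 0 < x) (c : ℤ) :
    ⌈Real.logb 2 x⌉ ≤ c ↔ x ≤ 2 ^ c := by
  rw [Int.ceil_le, Real.logb_le_iff_le_rpow one_lt_two hx, Real.rpow_intCast]

/-- **Local minmax variant (equation (8)).**
If at every step `j` of the bracketing model (while `Δ_j > 1`) the probe
satisfies `|k_j − x_{1/2,j}| ≤ 2^{⌈log₂ Δ_j⌉ − 1} − Δ_j/2`, then
`⌈log₂ Δ_{j+1}⌉ ≤ ⌈log₂ Δ_j⌉ − 1` at every step, and consequently, for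
every `j`, the run terminates within at most `⌈log₂ Δ_j⌉` further
iterations after step `j` (in particular within `⌈log₂ n⌉` iterations in
total). -/
theorem local_minmax_variant
    (n : ℤ) (hn : 2 ≤ n)
    (a b k : ℕ → ℤ) (ha0 : a 0 = 0) (hb0 : b 0 = n)
    (hrun : ∀ j : ℕ,
      (1 < b j - a j → a j < k j ∧ k j < b j ∧
        ((a (j+1) = a j ∧ b (j+1) = k j) ∨
         (a (j+1) = k j ∧ b (j+1) = b j) ∨
         (a (j+1) = k j ∧ b (j+1) = k j + 1))) ∧
      (b j - a j ≤ 1 → a (j+1) = a j ∧ b (j+1) = b j))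
    (hprobe : ∀ j : ℕ, 1 < b j - a j →
      |(k j : ℝ) - ((a j : ℝ) + (b j : ℝ)) / 2|
        ≤ 2 ^ (⌈Real.logb 2 ((b j : ℝ) - (a j : ℝ))⌉ - 1)
            - ((b j : ℝ) - (a j : ℝ)) / 2) :
    (∀ j : ℕ, 1 < b j - a j →
      ⌈Real.logb 2 ((b (j+1) : ℝ) - (a (j+1) : ℝ))⌉
        ≤ ⌈Real.logb 2 ((b j : ℝ) - (a j : ℝ))⌉ - 1) ∧
    (∀ j m : ℕ, ⌈Real.logb 2 ((b j : ℝ) - (a j : ℝ))⌉ ≤ (m : ℤ) →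
      b (j + m) - a (j + m) ≤ 1) ∧
    (∀ m : ℕ, ⌈Real.logb 2 (n : ℝ)⌉ ≤ (m : ℤ) → b m - a m ≤ 1) := by
  have hpos : ∀ j, 0 < b j - a j := by
    intro j
    induction j with
    | zero => omega
    | succ j ih =>
      have := hrun j
      grind
  have hposR : ∀ j, (0 : ℝ) < (b j : ℝ) - (a j : ℝ) := fun j => by exact_mod_cast hpos j
  have hstep : ∀ j : ℕ, 1 < b j - a j →
      ⌈Real.logb 2 ((b (j+1) : ℝ) - (a (j+1) : ℝ))⌉
        ≤ ⌈Real.logb 2 ((b j : ℝ) - (a j : ℝ))⌉ - 1 := by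
    intro j hj
    rw [ceil_logb_two_le_iff (hposR (j + 1))]
    obtain ⟨hak, hkb, hupd⟩ := (hrun j).1 hj
    have hle := abs_le.mp (hprobe j hj)
    have hak' : (a j : ℝ) + 1 ≤ k j := by exact_mod_cast hak
    rcases hupd with ⟨ha, hb⟩ | ⟨ha, hb⟩ | ⟨ha, hb⟩ <;> rw [ha, hb] <;> push_cast <;>
      linarith [hle.1, hle.2]
  have hterm : ∀ m j : ℕ, ⌈Real.logb 2 ((b j : ℝ) - (a j : ℝ))⌉ ≤ (m : ℤ) →
      b (j + m) - a (j + m) ≤ 1 := by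
    intro m
    induction m with
    | zero =>
      intro j h
      rw [ceil_logb_two_le_iff (hposR j)] at h
      norm_num at h
      have : (b j : ℝ) - a j ≤ 1 := by linarith
      exact_mod_cast this
    | succ m ih =>
      intro j h
      rw [show j + (m + 1) = j + 1 + m by omega]
      apply ih (j + 1)
      by_cases hj : 1 < b j - a j
      · have := hstep j hj
        push_cast at h
        omega
      · obtain ⟨ha, hb⟩ := (hrun j).2 (not_lt.mp hj)
        have h1 : (b j : ℝ) - a j = 1 := by
          have := hpos j
          exact_mod_cast (show b j - a j = 1 by omega)
        rw [ha, hb, h1]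
        simp
  refine ⟨hstep, fun j m => hterm m j, fun m hm => ?_⟩
  simpa using hterm m 0 (by simpa [ha0, hb0] using hm)
end

section
/- Relaxation claim for equation (7): Let a < b be integers with Δ = b − a ≥ 2 and let N_max be a natural number with N_max ≥ ⌈log_2 Δ⌉ + 1. Then every integer k with a < k < b satisfies |k − (a + b)/2| ≤ 2^{N_max − 1} − Δ/2; that is, with one iteration more than the minmax budget ⌈log_2 Δ⌉, the relaxed minmax condition |k − x_{1/2}| ≤ 2^{N_max − 1} − Δ/2 encompasses the entirety of the open bracket (a, b) at the first iteration. -/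
/-- **Relaxation claim for equation (7).**
Let `a < b` be integers with `Δ = b − a ≥ 2` and let `N_max` be a natural
number with `N_max ≥ ⌈log₂ Δ⌉ + 1`.  Then every integer `k` with
`a < k < b` satisfies `|k − (a+b)/2| ≤ 2^{N_max − 1} − Δ/2`: with one
iteration more than the minmax budget `⌈log₂ Δ⌉`, the relaxed minmax
condition encompasses the entirety of the open bracket `(a, b)` at the
first iteration. -/
theorem relaxed_minmax_encompasses_bracket
    (a b k : ℤ) (Nmax : ℕ)
    (hΔ : 2 ≤ b - a)
    (hN : ⌈Real.logb 2 ((b : ℝ) - (a : ℝ))⌉ + 1 ≤ (Nmax : ℤ))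
    (hka : a < k) (hkb : k < b) :
    |(k : ℝ) - ((a : ℝ) + (b : ℝ)) / 2|
      ≤ 2 ^ ((Nmax : ℤ) - 1) - ((b : ℝ) - (a : ℝ)) / 2 := by
  have hka' : (a : ℝ) < k := by exact_mod_cast hka
  have hkb' : (k : ℝ) < b := by exact_mod_cast hkb
  have hpos : (0 : ℝ) < (b : ℝ) - a := by linarith
  have hlog : Real.logb 2 ((b : ℝ) - a) ≤ (((Nmax : ℤ) - 1 : ℤ) : ℝ) :=
    Int.ceil_le.mp (by linarith)
  have hpow : (b : ℝ) - a ≤ 2 ^ ((Nmax : ℤ) - 1) := by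
    rwa [Real.logb_le_iff_le_rpow one_lt_two hpos, Real.rpow_intCast] at hlog
  rw [abs_le]
  constructor <;> linarith
end

section
/- Double-logarithmic iteration count for the contraction map: Let κ_1 > 0 and κ_2 ∈ (1/2, 1), define g(x) = 8 κ_1 x^{κ_2} on (0,∞), and let κ_4 be any real with κ_4 > max((8κ_1)^{1/(1−κ_2)}, 2). Then there exist constants C_1, C_2 > 0, depending only on κ_1, κ_2 and κ_4, such that for every Δ ≥ 4 there exists m ∈ ℕ with m ≤ C_1 + C_2 · log_2 log_2 Δ and g^[m](Δ) ≤ κ_4. -/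
theorem iterate_rpow_contraction {a : ℝ} (ha : 0 < a) (p : ℝ) (t : ℝ) (m : ℕ) :
    (fun x : ℝ => a ^ (1 - p) * x ^ p)^[m] (a * Real.exp t) = a * Real.exp (p ^ m * t) := by
  induction m with
  | zero => simp
  | succ k ih =>
    rw [Function.iterate_succ_apply', ih]
    rw [Real.mul_rpow ha.le (Real.exp_pos _).le, ← mul_assoc, ← Real.rpow_add ha,
      sub_add_cancel, Real.rpow_one, ← Real.exp_mul]
    ring_nf

/-- Geometric decay brings `K * L` below `ε` after `O(log L)` steps. -/
theorem exists_pow_mul_le {p K ε : ℝ} (hp0 : 0 < p) (hp1 : p < 1) (hK : 0 < K) (hε : 0 < ε)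
    {L : ℝ} (hL : 1 ≤ L) :
    ∃ m : ℕ, (m : ℝ) ≤ (|Real.log (K / ε)| + Real.log L) / (-Real.log p) + 1 ∧
      p ^ m * (K * L) ≤ ε := by
  have hc : 0 < -Real.log p := neg_pos.2 (Real.log_neg hp0 hp1)
  have hL0 : 0 < L := by linarith
  have hlogL : 0 ≤ Real.log L := Real.log_nonneg hL
  refine ⟨⌈(|Real.log (K / ε)| + Real.log L) / (-Real.log p)⌉₊,
    (Nat.ceil_lt_add_one (by positivity)).le, ?_⟩
  have hm := Nat.le_ceil ((|Real.log (K / ε)| + Real.log L) / (-Real.log p))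
  generalize ⌈(|Real.log (K / ε)| + Real.log L) / (-Real.log p)⌉₊ = m at hm ⊢
  rw [div_le_iff₀ hc] at hm
  have habs := le_abs_self (Real.log (K / ε))
  rw [Real.log_div hK.ne' hε.ne'] at habs hm
  rw [← Real.log_le_log_iff (by positivity) hε, Real.log_mul (by positivity) (by positivity),
    Real.log_pow, Real.log_mul hK.ne' hL0.ne']
  linarith

/-- **Double-logarithmic iteration count for the contraction map.**
Let `κ₁ > 0`, `κ₂ ∈ (1/2, 1)`, `g x = 8 κ₁ x^{κ₂}`, and let `κ₄` be any
real with `κ₄ > max ((8κ₁)^{1/(1−κ₂)}) 2`.  Then there exist constants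
`C₁, C₂ > 0`, depending only on `κ₁, κ₂, κ₄`, such that for every `Δ ≥ 4`
there exists `m ∈ ℕ` with `m ≤ C₁ + C₂ · log₂ log₂ Δ` and `g^[m] Δ ≤ κ₄`. -/
theorem contraction_double_log_iterations
    (κ1 κ2 κ4 : ℝ) (hκ1 : 0 < κ1) (hκ2 : κ2 ∈ Set.Ioo (1/2 : ℝ) 1)
    (hκ4 : max ((8 * κ1) ^ (1 / (1 - κ2))) 2 < κ4) :
    ∃ C1 > (0 : ℝ), ∃ C2 > (0 : ℝ), ∀ Δ : ℝ, 4 ≤ Δ →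
      ∃ m : ℕ, (m : ℝ) ≤ C1 + C2 * Real.logb 2 (Real.logb 2 Δ) ∧
        (fun x : ℝ => 8 * κ1 * x ^ κ2)^[m] Δ ≤ κ4 := by
  obtain ⟨hp, hp1⟩ := hκ2
  have hp0 : 0 < κ2 := by linarith
  have hk : 0 < 8 * κ1 := by positivity
  obtain ⟨a, ha_def⟩ : ∃ a, a = (8 * κ1) ^ (1 / (1 - κ2)) := ⟨_, rfl⟩
  have ha : 0 < a := ha_def ▸ Real.rpow_pos_of_pos hk _
  have hak : 8 * κ1 = a ^ (1 - κ2) := by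
    rw [ha_def, ← Real.rpow_mul hk.le, one_div_mul_cancel (by linarith), Real.rpow_one]
  rw [← ha_def] at hκ4
  have ha4 : a < κ4 := (le_max_left _ _).trans_lt hκ4
  have hκ0 : 0 < κ4 := ha.trans ha4
  have hε : 0 < Real.log (κ4 / a) := Real.log_pos ((one_lt_div ha).2 ha4)
  have hlog2 : 0 < Real.log 2 := Real.log_pos one_lt_two
  have hK : 0 < Real.log 2 + |Real.log a| := by positivity
  have hc : 0 < -Real.log κ2 := neg_pos.2 (Real.log_neg hp0 hp1)
  refine ⟨|Real.log ((Real.log 2 + |Real.log a|) / Real.log (κ4 / a))| / (-Real.log κ2) + 1,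
    by positivity, Real.log 2 / (-Real.log κ2), by positivity, fun Δ hΔ => ?_⟩
  have hΔ0 : 0 < Δ := by linarith
  have hL : 1 ≤ Real.logb 2 Δ := by
    rw [Real.le_logb_iff_rpow_le one_lt_two hΔ0, Real.rpow_one]
    linarith
  obtain ⟨m, hm, hpow⟩ := exists_pow_mul_le hp0 hp1 hK hε hL
  refine ⟨m, hm.trans_eq ?_, ?_⟩
  · rw [Real.logb.eq_def 2 (Real.logb 2 Δ)]
    field_simp
    ring
  · have hΔa : Δ = a * Real.exp (Real.log (Δ / a)) := by
      rw [Real.exp_log (by positivity), mul_div_cancel₀ _ ha.ne']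
    have hbound : Real.log (Δ / a) ≤ (Real.log 2 + |Real.log a|) * Real.logb 2 Δ := by
      have hlogb : Real.log 2 * Real.logb 2 Δ = Real.log Δ := by
        rw [Real.logb, mul_div_cancel₀ _ hlog2.ne']
      rw [Real.log_div hΔ0.ne' ha.ne', add_mul, hlogb]
      have := le_mul_of_one_le_right (abs_nonneg (Real.log a)) hL
      linarith [neg_abs_le (Real.log a)]
    rw [hak, hΔa, iterate_rpow_contraction ha]
    calc a * Real.exp (κ2 ^ m * Real.log (Δ / a))
        ≤ a * Real.exp (Real.log (κ4 / a)) := by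
          gcongr
          exact (mul_le_mul_of_nonneg_left hbound (by positivity)).trans hpow
      _ = κ4 := by rw [Real.exp_log (by positivity), mul_div_cancel₀ _ ha.ne']
end

section
/- Resolution of the expected-complexity recursion (equation (14)): Let κ_1 > 0, κ_2 ∈ (1/2, 1), and κ_4 > max((8κ_1)^{1/(1−κ_2)}, 2), and let B ≥ 0. Suppose f : (0,∞) → [0,∞) satisfies f(Δ) ≤ 3 + f(8 κ_1 Δ^{κ_2}) for every Δ > κ_4, and f(Δ) ≤ B for every Δ ≤ κ_4. Then there exist constants C_1, C_2 > 0, depending only on κ_1, κ_2 and κ_4, such that f(Δ) ≤ B + 3(C_1 + C_2 · log_2 log_2 Δ) for every Δ ≥ 4. -/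
/-- If `f` grows by at most `3` along the map `Δ ↦ a Δ^k`, which in logarithmic scale contracts by
the factor `k` towards `s = log a / (1 - k)`, then `f` is at most `B + 3 n` wherever `n`
contractions suffice to come below the threshold `K`. -/
theorem le_add_three_mul_of_log_sub_mul_pow_le {a k K B s : ℝ} {f : ℝ → ℝ} (ha : 0 < a)
    (hK : 0 < K) (hs : Real.log a = (1 - k) * s)
    (hrec : ∀ x : ℝ, K < x → f x ≤ 3 + f (a * x ^ k))
    (hbase : ∀ x : ℝ, 0 < x → x ≤ K → f x ≤ B) (n : ℕ) :
    ∀ x : ℝ, 0 < x → (Real.log x - s) * k ^ n ≤ Real.log K - s → f x ≤ B + 3 * n := by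
  induction n with
  | zero =>
    intro x hx h
    have h' : Real.log x ≤ Real.log K := by linarith [h, pow_zero k, mul_one (Real.log x - s)]
    simpa using hbase x hx ((Real.log_le_log_iff hx hK).1 h')
  | succ n ih =>
    intro x hx h
    rcases le_or_gt x K with hxK | hxK
    · have := hbase x hx hxK
      have : (0 : ℝ) ≤ 3 * ((n + 1 : ℕ) : ℝ) := by positivity
      linarith
    · have hp : 0 < x ^ k := Real.rpow_pos_of_pos hx k
      have hlog : Real.log (a * x ^ k) - s = (Real.log x - s) * k := by
        rw [Real.log_mul ha.ne' hp.ne', Real.log_rpow hx, hs]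
        ring
      have := ih (a * x ^ k) (mul_pos ha hp) (by
        rw [hlog, mul_assoc, ← pow_succ']
        exact h)
      have := hrec x hxK
      push_cast
      linarith

/-- **Resolution of the expected-complexity recursion (equation (14)).**
Let `κ₁ > 0`, `κ₂ ∈ (1/2, 1)`, `κ₄ > max ((8κ₁)^{1/(1−κ₂)}) 2`.  There
exist constants `C₁, C₂ > 0`, depending only on `κ₁, κ₂, κ₄`, such that:
for every `B ≥ 0` and every `f : (0,∞) → [0,∞)` satisfying
`f Δ ≤ 3 + f (8 κ₁ Δ^{κ₂})` for all `Δ > κ₄` and `f Δ ≤ B` for all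
`0 < Δ ≤ κ₄`, one has `f Δ ≤ B + 3 (C₁ + C₂ · log₂ log₂ Δ)` for every
`Δ ≥ 4`. -/
theorem expected_complexity_recursion
    (κ1 κ2 κ4 : ℝ) (hκ1 : 0 < κ1) (hκ2 : κ2 ∈ Set.Ioo (1/2 : ℝ) 1)
    (hκ4 : max ((8 * κ1) ^ (1 / (1 - κ2))) 2 < κ4) :
    ∃ C1 > (0 : ℝ), ∃ C2 > (0 : ℝ),
      ∀ B : ℝ, 0 ≤ B → ∀ f : ℝ → ℝ,
        (∀ Δ : ℝ, 0 < Δ → 0 ≤ f Δ) →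
        (∀ Δ : ℝ, κ4 < Δ → f Δ ≤ 3 + f (8 * κ1 * Δ ^ κ2)) →
        (∀ Δ : ℝ, 0 < Δ → Δ ≤ κ4 → f Δ ≤ B) →
        ∀ Δ : ℝ, 4 ≤ Δ →
          f Δ ≤ B + 3 * (C1 + C2 * Real.logb 2 (Real.logb 2 Δ)) := by
  obtain ⟨hk, hk1⟩ := hκ2
  have hk0 : 0 < κ2 := by linarith
  have ha : 0 < 8 * κ1 := by positivity
  obtain ⟨hfix, h2⟩ := max_lt_iff.1 hκ4
  have hK : 0 < κ4 := by linarith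
  set s := Real.log (8 * κ1) / (1 - κ2) with hs_def
  have hs : Real.log (8 * κ1) = (1 - κ2) * s := by
    rw [hs_def, mul_div_cancel₀]
    linarith
  have hu : 0 < Real.log κ4 - s := by
    have h := Real.log_lt_log (Real.rpow_pos_of_pos ha _) hfix
    rw [Real.log_rpow ha, one_div_mul_eq_div] at h
    linarith
  set u := Real.log κ4 - s with hu_def
  have hc : 0 < Real.log κ2⁻¹ := Real.log_pos ((one_lt_inv₀ hk0).2 hk1)
  set c := Real.log κ2⁻¹ with hc_def
  have hM : 0 < (1 + |s|) / u := by positivity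
  set M := (1 + |s|) / u with hM_def
  have hl2 : 0 < Real.log 2 := Real.log_pos one_lt_two
  refine ⟨1 + |Real.log M| / c, by positivity, Real.log 2 / c, by positivity, ?_⟩
  intro B _ f _ hrec hbase x hx
  have hx0 : 0 < x := by linarith
  have hy : 1 ≤ Real.logb 2 x := by
    rw [Real.le_logb_iff_rpow_le one_lt_two hx0, Real.rpow_one]
    linarith
  have hlogx : Real.log x = Real.log 2 * Real.logb 2 x := by
    rw [Real.logb, mul_div_cancel₀ _ hl2.ne']
  have hlogy : Real.log (Real.logb 2 x) = Real.log 2 * Real.logb 2 (Real.logb 2 x) := by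
    rw [Real.logb, Real.logb, mul_div_cancel₀ _ hl2.ne']
  set y := Real.logb 2 x
  have hy0 : 0 < y := by linarith
  have hly : 0 ≤ Real.log y := Real.log_nonneg hy
  set t := (|Real.log M| + Real.log y) / c with ht_def
  have ht : 0 ≤ t := by positivity
  have hn := Nat.ceil_lt_add_one ht
  have hMy : M * y ≤ κ2⁻¹ ^ ⌈t⌉₊ := by
    rw [← Real.log_le_log_iff (by positivity) (by positivity), Real.log_pow,
      Real.log_mul hM.ne' hy0.ne', ← hc_def]
    calc Real.log M + Real.log y ≤ |Real.log M| + Real.log y := by gcongr; exact le_abs_self _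
      _ = t * c := (div_mul_cancel₀ _ hc.ne').symm
      _ ≤ ⌈t⌉₊ * c := by gcongr; exact Nat.le_ceil t
  have hxs : Real.log x - s ≤ u * (M * y) := by
    have huM : u * (M * y) = (1 + |s|) * y := by rw [hM_def]; field_simp
    have hl : Real.log 2 ≤ 1 := by linarith [Real.log_two_lt_d9]
    rw [huM, hlogx]
    nlinarith [neg_abs_le s, abs_nonneg s]
  have hiter := le_add_three_mul_of_log_sub_mul_pow_le ha hK hs hrec hbase ⌈t⌉₊ x hx0 (by
    calc (Real.log x - s) * κ2 ^ ⌈t⌉₊ ≤ u * κ2⁻¹ ^ ⌈t⌉₊ * κ2 ^ ⌈t⌉₊ := by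
          gcongr
          exact hxs.trans (by gcongr)
      _ = u := by rw [mul_assoc, ← mul_pow, inv_mul_cancel₀ hk0.ne', one_pow, mul_one])
  have htC : t = |Real.log M| / c + Real.log 2 / c * Real.logb 2 y := by
    rw [ht_def, hlogy]
    ring
  linarith
end

section
/- Growth of the fraction covered by the minmax interval: Let N and j be natural numbers and write r = 2^{N−j−1}. (i) If Δ and Δ' are reals with 0 < Δ' ≤ Δ/2, then 2(2^{N−j−2} − Δ'/2)/Δ' ≥ 2(2^{N−j−1} − Δ/2)/Δ; i.e., after a successful iteration the fraction F(j) = 2(2^{N−j−1} − Δ_j/2)/Δ_j of the bracket covered by the minmax interval does not decrease. (ii) If moreover Δ/2 < r < Δ and Δ' = Δ − r (the case where the probe is the projection onto the boundary of the minmax interval), then, setting F = (2r − Δ)/Δ and F' = (r − Δ')/Δ', one has F > 0 and F' > 2F; i.e., the covered fraction more than doubles. -/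
/-- **Growth of the fraction covered by the minmax interval.**
Let `N, j` be naturals and `r = 2^{N−j−1}`.
(i) If `0 < Δ' ≤ Δ/2` then
`2(2^{N−j−2} − Δ'/2)/Δ' ≥ 2(2^{N−j−1} − Δ/2)/Δ`: after a successful
iteration the covered fraction does not decrease.
(ii) If moreover `Δ/2 < r < Δ` and `Δ' = Δ − r` (probe projected onto the
boundary of the minmax interval), then with `F = (2r − Δ)/Δ` and
`F' = (r − Δ')/Δ'` one has `F > 0` and `F' > 2F`: the covered fraction
more than doubles. -/
theorem minmax_fraction_growth (N j : ℕ) :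
    (∀ Δ Δ' : ℝ, 0 < Δ' → Δ' ≤ Δ / 2 →
      2 * ((2 : ℝ) ^ ((N : ℤ) - j - 2) - Δ' / 2) / Δ'
        ≥ 2 * ((2 : ℝ) ^ ((N : ℤ) - j - 1) - Δ / 2) / Δ) ∧
    (∀ Δ Δ' r F F' : ℝ,
      r = (2 : ℝ) ^ ((N : ℤ) - j - 1) →
      Δ / 2 < r → r < Δ → Δ' = Δ - r →
      F = (2 * r - Δ) / Δ → F' = (r - Δ') / Δ' →
      0 < F ∧ 2 * F < F') := by
  have hr : (0 : ℝ) < (2 : ℝ) ^ ((N : ℤ) - j - 1) := by positivity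
  refine ⟨fun Δ Δ' hΔ' hle => ?_, ?_⟩
  · have hΔ : 0 < Δ := by linarith
    have hhalf : (2 : ℝ) ^ ((N : ℤ) - j - 2) = (2 : ℝ) ^ ((N : ℤ) - j - 1) / 2 := by
      rw [div_eq_mul_inv, ← zpow_sub_one₀ two_ne_zero]
      congr 1
      ring
    rw [hhalf, ge_iff_le, div_le_div_iff₀ hΔ hΔ']
    nlinarith
  · rintro Δ Δ' r F F' rfl h₁ h₂ rfl rfl rfl
    generalize (2 : ℝ) ^ ((N : ℤ) - j - 1) = r at *
    have hΔ : 0 < Δ := hr.trans h₂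
    have hΔ' : 0 < Δ - r := sub_pos.mpr h₂
    have hF : 0 < 2 * r - Δ := by linarith
    refine ⟨div_pos hF hΔ, ?_⟩
    rw [← mul_div_assoc, div_lt_div_iff₀ hΔ hΔ']
    nlinarith
end
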